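/- arXiv:1607.05766 — 2 statements merged into one kernel-verified Lean document; each statement's English description precedes it below -/
import Mathlib

section
/- Let p, q ≥ 2 be integers and set s = p + q and C_{p,q} = −pq·s·√(((p−1)/(s−1))^p)·√(((q−1)/(s−1))^q). Then the quantity I = C_{p,q} · ∫₀^π [ (2s² − 10s + 9)·(sin t)^{s−4} − (2s² − 8s + 5)·(sin t)^{s−2} ] dt is strictly positive. -/
open Real

/-- With `s = n + 4`, the integral collapses to a negative multiple of `∫ sin ^ n`, by the
reduction formula for powers of the sine. -/
theorem integral_sin_pow_combination (n : ℕ) {s : ℝ} (hs : s = n + 4) :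
    ∫ t in (0 : ℝ)..π, ((2 * s ^ 2 - 10 * s + 9) * sin t ^ n -
      (2 * s ^ 2 - 8 * s + 5) * sin t ^ (n + 2)) =
        -(3 / ((n : ℝ) + 2)) * ∫ t in (0 : ℝ)..π, sin t ^ n := by
  rw [intervalIntegral.integral_sub (Continuous.intervalIntegrable (by fun_prop) _ _)
      (Continuous.intervalIntegrable (by fun_prop) _ _),
    intervalIntegral.integral_const_mul, intervalIntegral.integral_const_mul, integral_sin_pow]
  simp only [sin_zero, sin_pi, zero_pow n.succ_ne_zero, zero_mul, sub_zero, zero_div, zero_add]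
  have h : (n : ℝ) + 2 ≠ 0 := by positivity
  subst hs
  field_simp
  ring

/-- For integers `p, q ≥ 2`, with `s = p + q` and
`C_{p,q} = −pq·s·√(((p−1)/(s−1))^p)·√(((q−1)/(s−1))^q)`, the limiting stability integral
`I = C_{p,q} · ∫₀^π [(2s²−10s+9)(sin t)^{s−4} − (2s²−8s+5)(sin t)^{s−2}] dt` is strictly positive. -/
theorem bohm_limit_stability_integral_pos (p q : ℕ) (hp : 2 ≤ p) (hq : 2 ≤ q) :
    let s : ℕ := p + q
    let C : ℝ := -((p : ℝ) * q * s) * Real.sqrt ((((p : ℝ) - 1) / ((s : ℝ) - 1)) ^ p) *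
      Real.sqrt ((((q : ℝ) - 1) / ((s : ℝ) - 1)) ^ q)
    0 < C * ∫ t in (0 : ℝ)..π,
        ((2 * (s : ℝ) ^ 2 - 10 * (s : ℝ) + 9) * (Real.sin t) ^ (s - 4) -
          (2 * (s : ℝ) ^ 2 - 8 * (s : ℝ) + 5) * (Real.sin t) ^ (s - 2)) := by
  intro s C
  obtain ⟨n, hn⟩ : ∃ n, s = n + 4 := ⟨p + q - 4, by omega⟩
  have hp' : (2 : ℝ) ≤ p := by exact_mod_cast hp
  have hq' : (2 : ℝ) ≤ q := by exact_mod_cast hq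
  have hsR : (s : ℝ) = n + 4 := by exact_mod_cast hn
  have hs : (0 : ℝ) < s - 1 := by rw [hsR]; linarith [n.cast_nonneg (α := ℝ)]
  have hC : C < 0 := by
    have h₁ : 0 < √((((p : ℝ) - 1) / ((s : ℝ) - 1)) ^ p) :=
      sqrt_pos.2 (pow_pos (div_pos (by linarith) hs) _)
    have h₂ : 0 < √((((q : ℝ) - 1) / ((s : ℝ) - 1)) ^ q) :=
      sqrt_pos.2 (pow_pos (div_pos (by linarith) hs) _)
    have h₃ : 0 < (p : ℝ) * q * s := by
      have : (0 : ℝ) < s := by linarith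
      positivity
    exact mul_neg_of_neg_of_pos (mul_neg_of_neg_of_pos (neg_neg_of_pos h₃) h₁) h₂
  refine mul_pos_of_neg_of_neg hC ?_
  rw [show s - 4 = n by omega, show s - 2 = n + 2 by omega, integral_sin_pow_combination n hsR]
  exact mul_neg_of_neg_of_pos (neg_neg_of_pos (by positivity)) (integral_sin_pow_pos n)
end

section
/- For every real constant C > 0 there exists a continuous function φ : [0,1] → ℝ such that ∫₀¹ φ(x)·e^{−φ(x)} dx = 0 and ∫₀¹ φ(x)·e^{φ(x)} dx > C·∫₀¹ e^{φ(x)} dx. -/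
open Real

/-- Integral of `t * exp (-t)` along an affine parametrisation. -/
lemma integral_affine_mul_exp_neg {a : ℝ} (ha : a ≠ 0) (p : ℝ) :
    ∫ x in (0 : ℝ)..1, (a * x - p) * Real.exp (-(a * x - p)) =
      ((1 - p) * Real.exp p - (a - p + 1) * Real.exp (-(a - p))) / a := by
  have hderiv (x : ℝ) : HasDerivAt (fun x => -(a * x - p + 1) * Real.exp (-(a * x - p)) / a)
      ((a * x - p) * Real.exp (-(a * x - p))) x := by
    have h : HasDerivAt (fun x : ℝ => a * x - p) a x := by
      simpa using ((hasDerivAt_id x).const_mul a).sub_const p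
    refine (((h.add_const 1).neg.mul h.neg.exp).div_const a).congr_deriv ?_
    simp only [Pi.neg_apply]
    field_simp
    ring
  rw [intervalIntegral.integral_eq_sub_of_hasDerivAt (fun x _ => hderiv x)
    (Continuous.intervalIntegrable (by fun_prop) _ _)]
  simp only [mul_zero, mul_one, zero_sub, neg_neg]
  ring

/-- Integral of `t * exp t` along an affine parametrisation. -/
lemma integral_affine_mul_exp {a : ℝ} (ha : a ≠ 0) (p : ℝ) :
    ∫ x in (0 : ℝ)..1, (a * x - p) * Real.exp (a * x - p) =
      ((a - p - 1) * Real.exp (a - p) + (p + 1) * Real.exp (-p)) / a := by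
  have hderiv (x : ℝ) : HasDerivAt (fun x => (a * x - p - 1) * Real.exp (a * x - p) / a)
      ((a * x - p) * Real.exp (a * x - p)) x := by
    have h : HasDerivAt (fun x : ℝ => a * x - p) a x := by
      simpa using ((hasDerivAt_id x).const_mul a).sub_const p
    refine (((h.sub_const 1).mul h.exp).div_const a).congr_deriv ?_
    field_simp
    ring
  rw [intervalIntegral.integral_eq_sub_of_hasDerivAt (fun x _ => hderiv x)
    (Continuous.intervalIntegrable (by fun_prop) _ _)]
  simp only [mul_zero, mul_one, zero_sub]
  ring

/-- Integral of `exp` along an affine parametrisation. -/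
lemma integral_exp_affine {a : ℝ} (ha : a ≠ 0) (p : ℝ) :
    ∫ x in (0 : ℝ)..1, Real.exp (a * x - p) = (Real.exp (a - p) - Real.exp (-p)) / a := by
  rw [intervalIntegral.integral_comp_mul_sub _ ha, integral_exp]
  simp [div_eq_inv_mul]

/-- For `q ≥ 0` the level `(q + 1) * exp (-q)` is attained by `t ↦ (t + 1) * exp (-t)` at some
`t = -p ∈ [-1, 0]`. -/
lemma exists_one_sub_mul_exp_eq {q : ℝ} (hq : 0 ≤ q) :
    ∃ p ∈ Set.Icc (0 : ℝ) 1, (1 - p) * Real.exp p = (q + 1) * Real.exp (-q) := by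
  have hmem : (q + 1) * Real.exp (-q) ∈
      Set.Icc ((1 - 1) * Real.exp 1) ((1 - 0) * Real.exp 0) := by
    constructor
    · rw [sub_self, zero_mul]
      positivity
    · calc (q + 1) * Real.exp (-q) ≤ Real.exp q * Real.exp (-q) := by
            gcongr
            exact Real.add_one_le_exp q
        _ = (1 - 0) * Real.exp 0 := by rw [← Real.exp_add]; simp
  exact intermediate_value_Icc' (f := fun p : ℝ => (1 - p) * Real.exp p) zero_le_one
    (by fun_prop) hmem

/-- For every real `C > 0` there is a continuous function `φ` on `[0,1]` with
`∫₀¹ φ·e^{−φ} = 0` and `∫₀¹ φ·e^{φ} > C·∫₀¹ e^{φ}`. -/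
theorem exists_normalized_function_violating_inequality (C : ℝ) (hC : 0 < C) :
    ∃ φ : ℝ → ℝ, ContinuousOn φ (Set.Icc (0 : ℝ) 1) ∧
      (∫ x in (0 : ℝ)..1, φ x * Real.exp (-φ x)) = 0 ∧
      (∫ x in (0 : ℝ)..1, φ x * Real.exp (φ x)) > C * ∫ x in (0 : ℝ)..1, Real.exp (φ x) := by
  obtain ⟨p, ⟨hp, -⟩, hpq⟩ := exists_one_sub_mul_exp_eq (q := C + 1) (by positivity)
  have ha : 0 < C + 1 + p := by positivity
  refine ⟨fun x => (C + 1 + p) * x - p, by fun_prop, ?_, ?_⟩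
  · rw [integral_affine_mul_exp_neg ha.ne', hpq, add_sub_cancel_right, sub_self, zero_div]
  · rw [integral_affine_mul_exp ha.ne', integral_exp_affine ha.ne', gt_iff_lt, ← mul_div_assoc,
      add_sub_cancel_right]
    gcongr
    have hpos : 0 < (p + 1 + C) * Real.exp (-p) := by positivity
    linarith
end
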